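/- Let k be a field, n ≥ 3 an integer, and c : S₃ → k a function such that for every a ∈ {1,2,3} there exists a permutation σ with σ(1) = a and c(σ) ≠ 0. Let A be the quotient of the free associative unital k-algebra on x₁,…,xₙ by the two-sided ideal generated by r_i = Σ_{σ∈S₃} c(σ)·x_{i−1+σ(1)} x_{i−1+σ(2)} x_{i−1+σ(3)}, i = 1,…,n−2. Let ε : A → k be the augmentation, let g : A^n → A be the right A-module map g(a₁,…,aₙ) = Σ_{j=1}^n x̄_j a_j, and let f : A^{n−2} → A^n be the right A-module map whose j-th component on (b₁,…,b_{n−2}) is Σ_{i=1}^{n−2} p̄_{ij} b_i, where p_{ij} = Σ_{σ∈S₃, i−1+σ(1)=j} c(σ)·x_{i−1+σ(2)} x_{i−1+σ(3)} (so that r_i = Σ_j x_j p_{ij}). Then the sequence of right A-modules 0 → A^{n−2} → A^n → A → k → 0 (with maps f, g, ε) is exact: ε is surjective, ker ε = im g, ker g = im f, and f is injective. -/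

import Mathlib

open scoped BigOperators

noncomputable section

universe u

/-- The generator index `i + t` (0-based): for the `i`-th relation (`i = 0,…,n-3`),
the letters involved are `x_i, x_{i+1}, x_{i+2}` (which, 1-based, are the letters
`x_{i'-1+1}, x_{i'-1+2}, x_{i'-1+3}` of the `i'`-th relation, `i' = 1,…,n-2`). -/
def genIdx (n : ℕ) (i : Fin (n - 2)) (t : Fin 3) : Fin n :=
  ⟨i.val + t.val, by have hi := i.isLt; have ht := t.isLt; omega⟩

/-- The cubic relation `r_i = Σ_{σ ∈ S₃} c(σ) · x_{i-1+σ(1)} x_{i-1+σ(2)} x_{i-1+σ(3)}`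
(written 0-based) in the free associative unital algebra `F = k⟨x_1,…,x_n⟩`. -/
def rel (k : Type) [Field k] (n : ℕ) (c : Equiv.Perm (Fin 3) → k) (i : Fin (n - 2)) :
    FreeAlgebra k (Fin n) :=
  ∑ σ : Equiv.Perm (Fin 3),
    c σ • (FreeAlgebra.ι k (genIdx n i (σ 0)) * FreeAlgebra.ι k (genIdx n i (σ 1)) *
      FreeAlgebra.ι k (genIdx n i (σ 2)))

/-- The relation identifying each `r_i` with `0`; quotienting the free algebra by (the ring
congruence generated by) this relation is exactly quotienting by the two-sided ideal
generated by `r_1,…,r_{n-2}`. -/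
def relRel (k : Type) [Field k] (n : ℕ) (c : Equiv.Perm (Fin 3) → k)
    (a b : FreeAlgebra k (Fin n)) : Prop :=
  b = 0 ∧ ∃ i : Fin (n - 2), a = rel k n c i

/-- The algebra `A = k⟨x_1,…,x_n⟩ / (r_1,…,r_{n-2})`. -/
abbrev QuotAlg (k : Type) [Field k] (n : ℕ) (c : Equiv.Perm (Fin 3) → k) : Type :=
  RingQuot (relRel k n c)

/-- The image `x̄_j` of the generator `x_j` in `A`. -/
def Xbar (k : Type) [Field k] (n : ℕ) (c : Equiv.Perm (Fin 3) → k) (j : Fin n) :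
    QuotAlg k n c :=
  RingQuot.mkAlgHom k (relRel k n c) (FreeAlgebra.ι k j)

/-- The element `p_{ij} = Σ_{σ ∈ S₃, i-1+σ(1) = j} c(σ) · x_{i-1+σ(2)} x_{i-1+σ(3)}` of the
free algebra (0-based), so that `r_i = Σ_j x_j p_{ij}`. -/
def pGen (k : Type) [Field k] (n : ℕ) (c : Equiv.Perm (Fin 3) → k) (i : Fin (n - 2))
    (j : Fin n) : FreeAlgebra k (Fin n) :=
  ∑ σ ∈ Finset.univ.filter (fun σ : Equiv.Perm (Fin 3) => genIdx n i (σ 0) = j),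
    c σ • (FreeAlgebra.ι k (genIdx n i (σ 1)) * FreeAlgebra.ι k (genIdx n i (σ 2)))

/-- The image `p̄_{ij}` of `p_{ij}` in `A`. -/
def Pbar (k : Type) [Field k] (n : ℕ) (c : Equiv.Perm (Fin 3) → k) (i : Fin (n - 2))
    (j : Fin n) : QuotAlg k n c :=
  RingQuot.mkAlgHom k (relRel k n c) (pGen k n c i j)

/-- The augmentation `ε : A → k`, the unique `k`-algebra map sending every `x̄_j` to `0`. -/
def aug (k : Type) [Field k] (n : ℕ) (c : Equiv.Perm (Fin 3) → k) :
    QuotAlg k n c →ₐ[k] k :=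
  RingQuot.liftAlgHom k ⟨FreeAlgebra.lift k (fun _ => (0 : k)), by
    rintro a b ⟨rfl, i, rfl⟩
    simp [rel, FreeAlgebra.lift_ι_apply]⟩

/-- The `A`-module `M` has projective dimension at most 2: there is an exact sequence
`0 → P₂ → P₁ → P₀ → M → 0` with all `Pᵢ` projective. -/
def HasProjDimLE2 (A : Type) [Ring A] (M : Type u) [AddCommGroup M] [Module A M] : Prop :=
  ∃ P₂ P₁ P₀ : ModuleCat.{u} A,
    Module.Projective A P₂ ∧ Module.Projective A P₁ ∧ Module.Projective A P₀ ∧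
    ∃ (f₂ : P₂ →ₗ[A] P₁) (f₁ : P₁ →ₗ[A] P₀) (f₀ : P₀ →ₗ[A] M),
      Function.Injective f₂ ∧
      LinearMap.range f₂ = LinearMap.ker f₁ ∧
      LinearMap.range f₁ = LinearMap.ker f₀ ∧
      Function.Surjective f₀

/-- The `A`-module `M` has projective dimension at most 1: there is an exact sequence
`0 → P₁ → P₀ → M → 0` with `P₀, P₁` projective. -/
def HasProjDimLE1 (A : Type) [Ring A] (M : Type u) [AddCommGroup M] [Module A M] : Prop :=
  ∃ P₁ P₀ : ModuleCat.{u} A,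
    Module.Projective A P₁ ∧ Module.Projective A P₀ ∧
    ∃ (f₁ : P₁ →ₗ[A] P₀) (f₀ : P₀ →ₗ[A] M),
      Function.Injective f₁ ∧
      LinearMap.range f₁ = LinearMap.ker f₀ ∧
      Function.Surjective f₀

/-- A sum over `S₃` written out, the two permutations fixing `0` first. -/
theorem sum_perm_fin_three {M : Type*} [AddCommMonoid M] (f : Equiv.Perm (Fin 3) → M) :
    ∑ π, f π = f 1 + (f (Equiv.swap 1 2) + (f (Equiv.swap 0 1) + (f (finRotate 3) +
      (f (Equiv.swap 0 2) + f (finRotate 3)⁻¹)))) := by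
  have h : (Finset.univ : Finset (Equiv.Perm (Fin 3))) =
      {1, Equiv.swap 1 2, Equiv.swap 0 1, finRotate 3, Equiv.swap 0 2, (finRotate 3)⁻¹} := by
    decide
  rw [h, Finset.sum_insert (by decide), Finset.sum_insert (by decide),
    Finset.sum_insert (by decide), Finset.sum_insert (by decide), Finset.sum_insert (by decide),
    Finset.sum_singleton]

section Rewriting

variable {k X ι : Type*} [Field k]

/-- Prepending a letter to every word. -/
def consMap (k : Type*) {X : Type*} [Field k] (a : X) : (List X →₀ k) →ₗ[k] (List X →₀ k) :=
  Finsupp.lmapDomain k k (List.cons a)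

theorem consMap_single (a : X) (w : List X) (r : k) :
    consMap k a (Finsupp.single w r) = Finsupp.single (a :: w) r := by
  simp [consMap]

theorem consMap_apply_cons (a : X) (m : List X →₀ k) (w : List X) :
    consMap k a m (a :: w) = m w :=
  Finsupp.mapDomain_apply (List.cons_injective) m w

theorem consMap_apply_cons_of_ne {a b : X} (h : a ≠ b) (m : List X →₀ k) (w : List X) :
    consMap k a m (b :: w) = 0 := by
  refine Finsupp.mapDomain_of_notMem_range _ _ ?_
  rintro ⟨v, hv⟩
  exact h (List.cons.inj hv).1

/-- The cubic element of the free algebra with letters `L i 0, L i 1, L i 2` and coefficients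
`d i`. -/
def cubicRel (L : ι → Fin 3 → X) (d : ι → Equiv.Perm (Fin 3) → k) (i : ι) : FreeAlgebra k X :=
  ∑ π : Equiv.Perm (Fin 3), d i π • (FreeAlgebra.ι k (L i (π 0)) * FreeAlgebra.ι k (L i (π 1)) *
    FreeAlgebra.ι k (L i (π 2)))

theorem cubicRel_eq (L : ι → Fin 3 → X) (d : ι → Equiv.Perm (Fin 3) → k) (i : ι) :
    cubicRel L d i =
      d i 1 •
        (FreeAlgebra.ι k (L i 0) * FreeAlgebra.ι k (L i 1) * FreeAlgebra.ι k (L i 2)) +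
      (d i (Equiv.swap 1 2) •
        (FreeAlgebra.ι k (L i 0) * FreeAlgebra.ι k (L i 2) * FreeAlgebra.ι k (L i 1)) +
      (d i (Equiv.swap 0 1) •
        (FreeAlgebra.ι k (L i 1) * FreeAlgebra.ι k (L i 0) * FreeAlgebra.ι k (L i 2)) +
      (d i (finRotate 3) •
        (FreeAlgebra.ι k (L i 1) * FreeAlgebra.ι k (L i 2) * FreeAlgebra.ι k (L i 0)) +
      (d i (Equiv.swap 0 2) •
        (FreeAlgebra.ι k (L i 2) * FreeAlgebra.ι k (L i 1) * FreeAlgebra.ι k (L i 0)) +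
      d i (finRotate 3)⁻¹ •
        (FreeAlgebra.ι k (L i 2) * FreeAlgebra.ι k (L i 0) * FreeAlgebra.ι k (L i 1)))))) := by
  have p1 : finRotate 3 0 = 1 := by decide
  have p2 : finRotate 3 1 = 2 := by decide
  have p3 : finRotate 3 2 = 0 := by decide
  have q1 : (finRotate 3)⁻¹ 0 = 2 := by decide
  have q2 : (finRotate 3)⁻¹ 1 = 0 := by decide
  have q3 : (finRotate 3)⁻¹ 2 = 1 := by decide
  have s1 : Equiv.swap (1 : Fin 3) 2 0 = 0 := by decide
  have s2 : Equiv.swap (0 : Fin 3) 1 2 = 2 := by decide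
  have s3 : Equiv.swap (0 : Fin 3) 2 1 = 1 := by decide
  simp only [cubicRel, sum_perm_fin_three, p1, p2, p3, q1, q2, q3, s1, s2, s3,
    Equiv.swap_apply_left, Equiv.swap_apply_right, Equiv.Perm.coe_one, id]

open Classical in
/-- The product of a letter `y` and a word, with every occurrence of a leading word
`L i 0, L i 1, L i 2` at its start rewritten by means of the relation `cubicRel L d i`. -/
def rewriteMul (L : ι → Fin 3 → X) (d : ι → Equiv.Perm (Fin 3) → k) (y : X) :
    List X → (List X →₀ k)
  | a :: b :: w =>
    if h : ∃ i, L i 0 = y ∧ L i 1 = a ∧ L i 2 = b then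
      -(d h.choose 1)⁻¹ • (d h.choose (Equiv.swap 1 2) • Finsupp.single (y :: b :: a :: w) 1 +
        (d h.choose (Equiv.swap 0 1) • consMap k a (rewriteMul L d y (b :: w)) +
        (d h.choose (finRotate 3) • consMap k a (consMap k b (rewriteMul L d y w)) +
        (d h.choose (Equiv.swap 0 2) • consMap k b (consMap k a (rewriteMul L d y w)) +
        d h.choose (finRotate 3)⁻¹ • consMap k b (rewriteMul L d y (a :: w))))))
    else Finsupp.single (y :: a :: b :: w) 1
  | w => Finsupp.single (y :: w) 1
  termination_by w => w.length

variable {L : ι → Fin 3 → X} {d : ι → Equiv.Perm (Fin 3) → k}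

theorem rewriteMul_of_not_lead {y : X} {w : List X}
    (h : ∀ i v, L i 0 = y → w ≠ L i 1 :: L i 2 :: v) :
    rewriteMul L d y w = Finsupp.single (y :: w) 1 := by
  match w with
  | [] => rw [rewriteMul]; simp
  | [a] => rw [rewriteMul]; simp
  | a :: b :: w =>
    rw [rewriteMul, dif_neg]
    rintro ⟨i, hy, rfl, rfl⟩
    exact h i w hy rfl

theorem rewriteMul_lead (hL : ∀ i j, L i 0 = L j 0 → L i 1 = L j 1 → L i 2 = L j 2 → i = j)
    (i : ι) (w : List X) :
    rewriteMul L d (L i 0) (L i 1 :: L i 2 :: w) =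
      -(d i 1)⁻¹ • (d i (Equiv.swap 1 2) • Finsupp.single (L i 0 :: L i 2 :: L i 1 :: w) 1 +
        (d i (Equiv.swap 0 1) • consMap k (L i 1) (rewriteMul L d (L i 0) (L i 2 :: w)) +
        (d i (finRotate 3) •
          consMap k (L i 1) (consMap k (L i 2) (rewriteMul L d (L i 0) w)) +
        (d i (Equiv.swap 0 2) •
          consMap k (L i 2) (consMap k (L i 1) (rewriteMul L d (L i 0) w)) +
        d i (finRotate 3)⁻¹ •
          consMap k (L i 2) (rewriteMul L d (L i 0) (L i 1 :: w)))))) := by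
  have h : ∃ j, L j 0 = L i 0 ∧ L j 1 = L i 1 ∧ L j 2 = L i 2 := ⟨i, rfl, rfl, rfl⟩
  have hi : h.choose = i := hL _ _ h.choose_spec.1 h.choose_spec.2.1 h.choose_spec.2.2
  rw [rewriteMul, dif_pos h, hi]

/-- The action of the free algebra on the span of all words through `rewriteMul`. -/
def rewriteAction (L : ι → Fin 3 → X) (d : ι → Equiv.Perm (Fin 3) → k) :
    FreeAlgebra k X →ₐ[k] Module.End k (List X →₀ k) :=
  FreeAlgebra.lift k fun y => Finsupp.linearCombination k (rewriteMul L d y)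

theorem rewriteAction_ι_single (y : X) (w : List X) :
    rewriteAction L d (FreeAlgebra.ι k y) (Finsupp.single w 1) = rewriteMul L d y w := by
  simp [rewriteAction]

theorem rewriteAction_ι_of_forall_ne {y : X} (h : ∀ i, L i 0 ≠ y) :
    rewriteAction L d (FreeAlgebra.ι k y) = consMap k y := by
  refine Finsupp.lhom_ext' fun w => LinearMap.ext_ring ?_
  simp only [LinearMap.comp_apply, Finsupp.lsingle_apply]
  rw [rewriteAction_ι_single, consMap_single, rewriteMul_of_not_lead fun i _ hi => (h i hi).elim]

theorem rewriteAction_cubicRel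
    (hL : ∀ i j, L i 0 = L j 0 → L i 1 = L j 1 → L i 2 = L j 2 → i = j)
    (hL' : ∀ i j, L i 0 = L j 0 → L i 1 = L j 2 → L i 2 ≠ L j 1)
    (h₁ : ∀ i j, L i 0 ≠ L j 1) (h₂ : ∀ i j, L i 0 ≠ L j 2) (hd : ∀ i, d i 1 ≠ 0) (i : ι) :
    rewriteAction L d (cubicRel L d i) = 0 := by
  refine Finsupp.lhom_ext' fun w => LinearMap.ext_ring ?_
  have e₁ : rewriteAction L d (FreeAlgebra.ι k (L i 1)) = consMap k (L i 1) :=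
    rewriteAction_ι_of_forall_ne fun j => h₁ j i
  have e₂ : rewriteAction L d (FreeAlgebra.ι k (L i 2)) = consMap k (L i 2) :=
    rewriteAction_ι_of_forall_ne fun j => h₂ j i
  have e₃ : rewriteMul L d (L i 0) (L i 2 :: L i 1 :: w) =
      Finsupp.single (L i 0 :: L i 2 :: L i 1 :: w) 1 := by
    refine rewriteMul_of_not_lead fun j v hj hw => ?_
    simp only [List.cons.injEq] at hw
    exact hL' j i hj hw.1.symm hw.2.1.symm
  rw [cubicRel_eq]
  simp only [map_add, map_smul, map_mul, e₁, e₂, LinearMap.comp_apply,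
    Finsupp.lsingle_apply, LinearMap.add_apply, LinearMap.smul_apply, Module.End.mul_apply,
    consMap_single, rewriteAction_ι_single, e₃, LinearMap.zero_apply]
  rw [rewriteMul_lead hL, smul_smul, mul_neg, mul_inv_cancel₀ (hd i), neg_one_smul]
  exact neg_add_cancel _

variable {A : Type*} [Ring A] [Algebra k A] {p : FreeAlgebra k X →ₐ[k] A}

/-- The linear map taking a word to the product of the images of its letters. -/
def wordEval (p : FreeAlgebra k X →ₐ[k] A) : (List X →₀ k) →ₗ[k] A :=
  Finsupp.linearCombination k fun w => (w.map fun y => p (FreeAlgebra.ι k y)).prod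

theorem wordEval_single (w : List X) :
    wordEval p (Finsupp.single w 1) = (w.map fun y => p (FreeAlgebra.ι k y)).prod := by
  simp [wordEval]

theorem wordEval_consMap (a : X) (m : List X →₀ k) :
    wordEval p (consMap k a m) = p (FreeAlgebra.ι k a) * wordEval p m := by
  induction m using Finsupp.induction_linear with
  | zero => simp
  | add m₁ m₂ h₁ h₂ => simp only [map_add, h₁, h₂, mul_add]
  | single w r => rw [consMap_single]; simp [wordEval]

theorem wordEval_rewriteMul
    (hL : ∀ i j, L i 0 = L j 0 → L i 1 = L j 1 → L i 2 = L j 2 → i = j)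
    (hd : ∀ i, d i 1 ≠ 0) (hp : ∀ i, p (cubicRel L d i) = 0) (y : X) (w : List X) :
    wordEval p (rewriteMul L d y w) =
      p (FreeAlgebra.ι k y) * (w.map fun y => p (FreeAlgebra.ι k y)).prod := by
  induction hN : w.length using Nat.strong_induction_on generalizing w with
  | _ N ih =>
  subst hN
  by_cases h : ∃ i v, L i 0 = y ∧ w = L i 1 :: L i 2 :: v
  · obtain ⟨i, v, rfl, rfl⟩ := h
    have hr := hp i
    rw [cubicRel_eq] at hr
    simp only [map_add, map_smul, map_mul] at hr
    have hr' := congrArg (· * (v.map fun y => p (FreeAlgebra.ι k y)).prod) hr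
    simp only [add_mul, smul_mul_assoc, zero_mul, mul_assoc] at hr'
    rw [rewriteMul_lead hL]
    simp only [map_add, map_smul, wordEval_consMap, wordEval_single,
      ih _ (by simp : v.length < _) v rfl, ih _ (by simp : (L i 2 :: v).length < _) _ rfl,
      ih _ (by simp : (L i 1 :: v).length < _) _ rfl, List.map_cons, List.prod_cons]
    rw [← neg_eq_iff_add_eq_zero.mpr hr', neg_smul_neg, smul_smul, inv_mul_cancel₀ (hd i),
      one_smul]
  · rw [rewriteMul_of_not_lead fun i v hi hw => h ⟨i, v, hi, hw⟩, wordEval_single,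
      List.map_cons, List.prod_cons]

theorem wordEval_rewriteAction
    (hL : ∀ i j, L i 0 = L j 0 → L i 1 = L j 1 → L i 2 = L j 2 → i = j)
    (hd : ∀ i, d i 1 ≠ 0) (hp : ∀ i, p (cubicRel L d i) = 0) (u : FreeAlgebra k X)
    (m : List X →₀ k) :
    wordEval p (rewriteAction L d u m) = p u * wordEval p m := by
  induction u using FreeAlgebra.induction generalizing m with
  | grade0 r => simp [Algebra.smul_def]
  | grade1 y =>
    induction m using Finsupp.induction_linear with
    | zero => simp
    | add m₁ m₂ h₁ h₂ => simp only [map_add, h₁, h₂, mul_add]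
    | single w r =>
      rw [← mul_one r, ← smul_eq_mul, ← Finsupp.smul_single, map_smul, map_smul, map_smul,
        rewriteAction_ι_single, wordEval_rewriteMul hL hd hp, wordEval_single, mul_smul_comm]
  | mul u v hu hv => rw [map_mul, Module.End.mul_apply, hu, hv, map_mul, mul_assoc]
  | add u v hu hv => rw [map_add, LinearMap.add_apply, map_add, hu, hv, map_add, add_mul]

end Rewriting

section Presentation

variable {k : Type} [Field k] {n : ℕ} {c : Equiv.Perm (Fin 3) → k}

theorem rel_eq_sum_pGen (i : Fin (n - 2)) :
    rel k n c i = ∑ j, FreeAlgebra.ι k j * pGen k n c i j := by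
  simp only [pGen, rel, Finset.sum_filter, Finset.mul_sum]
  rw [Finset.sum_comm]
  simp [mul_assoc]

theorem mkAlgHom_rel (i : Fin (n - 2)) :
    RingQuot.mkAlgHom k (relRel k n c) (rel k n c i) = 0 := by
  rw [RingQuot.mkAlgHom_rel k (show relRel k n c (rel k n c i) 0 from ⟨rfl, i, rfl⟩), map_zero]

theorem sum_Xbar_mul_Pbar (i : Fin (n - 2)) : ∑ j, Xbar k n c j * Pbar k n c i j = 0 := by
  rw [← mkAlgHom_rel (c := c) i, rel_eq_sum_pGen, map_sum]
  simp only [map_mul, Xbar, Pbar]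

theorem aug_Xbar (j : Fin n) : aug k n c (Xbar k n c j) = 0 := by
  simp [aug, Xbar]

theorem exists_eq_aug_add (a : QuotAlg k n c) :
    ∃ v : Fin n → QuotAlg k n c,
      a = algebraMap k _ (aug k n c a) + ∑ j, Xbar k n c j * v j := by
  obtain ⟨u, rfl⟩ := RingQuot.mkAlgHom_surjective k (relRel k n c) a
  induction u using FreeAlgebra.induction with
  | grade0 r => exact ⟨0, by simp⟩
  | grade1 y =>
    refine ⟨Pi.single y 1, ?_⟩
    change Xbar k n c y = algebraMap k _ (aug k n c (Xbar k n c y)) + _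
    simp [aug_Xbar, Pi.single_apply]
  | mul u v hu hv =>
    obtain ⟨s, hs⟩ := hu
    obtain ⟨t, ht⟩ := hv
    refine ⟨fun j => s j * RingQuot.mkAlgHom k (relRel k n c) v +
      aug k n c (RingQuot.mkAlgHom k (relRel k n c) u) • t j, ?_⟩
    rw [map_mul]
    nth_rewrite 1 [hs]
    rw [add_mul]
    nth_rewrite 1 [ht]
    simp only [map_mul, mul_add, Finset.sum_add_distrib, Finset.sum_mul, mul_assoc,
      mul_smul_comm, ← Finset.smul_sum, ← Algebra.smul_def]
    abel
  | add u v hu hv =>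
    obtain ⟨s, hs⟩ := hu
    obtain ⟨t, ht⟩ := hv
    refine ⟨s + t, ?_⟩
    rw [map_add]
    nth_rewrite 1 [hs, ht]
    simp only [map_add, Pi.add_apply, mul_add, Finset.sum_add_distrib]
    abel

/-- The map `A^{n-2} → A^n` of the resolution, as a `k`-linear map. -/
def relMap (k : Type) [Field k] (n : ℕ) (c : Equiv.Perm (Fin 3) → k) :
    (Fin (n - 2) → QuotAlg k n c) →ₗ[k] (Fin n → QuotAlg k n c) :=
  LinearMap.pi fun j => ∑ i, LinearMap.mulLeft k (Pbar k n c i j) ∘ₗ LinearMap.proj i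

theorem relMap_apply (b : Fin (n - 2) → QuotAlg k n c) (j : Fin n) :
    relMap k n c b j = ∑ i, Pbar k n c i j * b i := by
  simp [relMap]

/-- Right multiplication by an element of `A` on the cokernel of `relMap`. -/
def cokerMulRight (a : QuotAlg k n c) :
    Module.End k ((Fin n → QuotAlg k n c) ⧸ LinearMap.range (relMap k n c)) :=
  Submodule.mapQ _ _ (LinearMap.mulRight k fun _ => a) <| by
    rintro _ ⟨b, rfl⟩
    refine ⟨fun i => b i * a, funext fun j => ?_⟩
    simp [relMap_apply, Finset.sum_mul, mul_assoc]

theorem cokerMulRight_mk (a : QuotAlg k n c) (v : Fin n → QuotAlg k n c) :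
    cokerMulRight a (Submodule.Quotient.mk v) = Submodule.Quotient.mk fun j => v j * a :=
  rfl

/-- The right action of the free algebra on the extension of `k` by the cokernel of `relMap`
in which `(1, 0)` is sent by `x_j` to the class of the `j`-th basis vector. -/
def extAction (k : Type) [Field k] (n : ℕ) (c : Equiv.Perm (Fin 3) → k) :
    FreeAlgebra k (Fin n) →ₐ[k]
      (Module.End k (k × ((Fin n → QuotAlg k n c) ⧸ LinearMap.range (relMap k n c))))ᵐᵒᵖ :=
  FreeAlgebra.lift k fun j => MulOpposite.op <| LinearMap.inr k _ _ ∘ₗ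
    (LinearMap.coprod (LinearMap.toSpanSingleton k _ (Submodule.Quotient.mk (Pi.single j 1)))
      (cokerMulRight (Xbar k n c j)))

theorem extAction_ι (j : Fin n) (s : k)
    (m : (Fin n → QuotAlg k n c) ⧸ LinearMap.range (relMap k n c)) :
    (extAction k n c (FreeAlgebra.ι k j)).unop (s, m) =
      (0, s • Submodule.Quotient.mk (Pi.single j 1) + cokerMulRight (Xbar k n c j) m) := by
  simp [extAction]

theorem extAction_inr (u : FreeAlgebra k (Fin n))
    (m : (Fin n → QuotAlg k n c) ⧸ LinearMap.range (relMap k n c)) :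
    (extAction k n c u).unop (0, m) =
      (0, cokerMulRight (RingQuot.mkAlgHom k (relRel k n c) u) m) := by
  induction u using FreeAlgebra.induction generalizing m with
  | grade0 r =>
    obtain ⟨v, rfl⟩ := Submodule.Quotient.mk_surjective _ m
    rw [AlgHom.commutes, AlgHom.commutes, cokerMulRight_mk]
    simp only [← Algebra.commutes r, ← Algebra.smul_def]
    simp [MulOpposite.algebraMap_apply, Module.algebraMap_end_apply]
    rfl
  | grade1 y => simp [extAction_ι, Xbar]
  | mul u v hu hv =>
    rw [map_mul, MulOpposite.unop_mul, Module.End.mul_apply, hu, hv]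
    obtain ⟨t, rfl⟩ := Submodule.Quotient.mk_surjective _ m
    simp only [cokerMulRight_mk, map_mul, mul_assoc]
  | add u v hu hv =>
    rw [map_add, MulOpposite.unop_add, LinearMap.add_apply, hu, hv]
    obtain ⟨t, rfl⟩ := Submodule.Quotient.mk_surjective _ m
    simp only [cokerMulRight_mk, map_add, mul_add, Prod.mk_add_mk, add_zero,
      ← Submodule.Quotient.mk_add]
    rfl

theorem extAction_sum_ι_mul (u : Fin n → FreeAlgebra k (Fin n)) (s : k)
    (v : Fin n → QuotAlg k n c) :
    (extAction k n c (∑ j, FreeAlgebra.ι k j * u j)).unop (s, Submodule.Quotient.mk v) =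
      (0, Submodule.Quotient.mk ((s • fun j => RingQuot.mkAlgHom k (relRel k n c) (u j)) +
        fun j => v j * RingQuot.mkAlgHom k (relRel k n c) (∑ j, FreeAlgebra.ι k j * u j))) := by
  have hj (j : Fin n) : (extAction k n c (FreeAlgebra.ι k j * u j)).unop
      (s, Submodule.Quotient.mk v) = LinearMap.inr k k _ (Submodule.mkQ _
        ((s • Pi.single j (RingQuot.mkAlgHom k (relRel k n c) (u j)) : Fin n → QuotAlg k n c) +
          fun l => v l * RingQuot.mkAlgHom k (relRel k n c) (FreeAlgebra.ι k j * u j))) := by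
    rw [map_mul, MulOpposite.unop_mul, Module.End.mul_apply, extAction_ι, extAction_inr,
      cokerMulRight_mk, ← Submodule.Quotient.mk_smul, ← Submodule.Quotient.mk_add,
      cokerMulRight_mk]
    refine congrArg (fun t => ((0 : k), Submodule.Quotient.mk t)) (funext fun l => ?_)
    by_cases h : l = j
    · subst h; simp [add_mul, mul_assoc, Xbar]
    · simp [h, mul_assoc, Xbar]
  rw [map_sum, Finset.unop_sum, LinearMap.sum_apply, Finset.sum_congr rfl fun j _ => hj j,
    ← map_sum, ← map_sum]
  refine congrArg (fun t => ((0 : k), Submodule.Quotient.mk t)) (funext fun l => ?_)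
  simp [Finset.sum_add_distrib, Finset.mul_sum, Pi.single_apply]

theorem extAction_rel (i : Fin (n - 2)) : extAction k n c (rel k n c i) = 0 := by
  refine MulOpposite.unop_injective (LinearMap.ext ?_)
  rintro ⟨s, m⟩
  obtain ⟨v, rfl⟩ := Submodule.Quotient.mk_surjective _ m
  rw [rel_eq_sum_pGen, extAction_sum_ι_mul, ← rel_eq_sum_pGen, mkAlgHom_rel]
  refine Prod.ext rfl ((Submodule.Quotient.mk_eq_zero _).2 ⟨Pi.single i (algebraMap k _ s), ?_⟩)
  funext j
  rw [relMap_apply, Finset.sum_eq_single i (fun l _ hl => by simp [hl]) (by simp)]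
  rw [Pi.single_eq_same, ← Algebra.commutes, ← Algebra.smul_def]
  simp [Pbar]

theorem mem_range_relMap {v : Fin n → QuotAlg k n c} (hv : ∑ j, Xbar k n c j * v j = 0) :
    v ∈ LinearMap.range (relMap k n c) := by
  choose u hu using fun j => RingQuot.mkAlgHom_surjective k (relRel k n c) (v j)
  have h0 : RingQuot.mkAlgHom k (relRel k n c) (∑ j, FreeAlgebra.ι k j * u j) = 0 := by
    rw [← hv, map_sum]
    simp only [map_mul, hu, Xbar]
  have h1 : extAction k n c (∑ j, FreeAlgebra.ι k j * u j) = 0 := by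
    have hr : ∀ ⦃a b⦄, relRel k n c a b → extAction k n c a = extAction k n c b := by
      rintro a b ⟨rfl, i, rfl⟩
      rw [extAction_rel, map_zero]
    rw [← RingQuot.liftAlgHom_mkAlgHom_apply k (extAction k n c) hr, h0, map_zero]
  have h2 := extAction_sum_ι_mul (c := c) u 1 0
  rw [h1, h0, one_smul] at h2
  have h3 := (congrArg Prod.snd h2).symm
  simp only [hu, mul_zero] at h3
  rw [← Submodule.Quotient.mk_eq_zero]
  refine (congrArg Submodule.Quotient.mk ?_).trans h3
  exact (add_zero v).symm

end Presentation

section Injectivity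

/-- The position, among `i, i + 1, i + 2`, of the multiple of `3`. -/
def pivotPos (i : ℕ) : Fin 3 := ⟨2 * i % 3, Nat.mod_lt _ (by decide)⟩

variable {k : Type} [Field k] {n : ℕ} {c : Equiv.Perm (Fin 3) → k}

/-- The letters of the `i`-th relation, listed in the order given by a permutation `s t` whose
first value `t` is the position of the letter with index divisible by `3`. -/
def pivotLetters (n : ℕ) (s : Fin 3 → Equiv.Perm (Fin 3)) (i : Fin (n - 2)) (t : Fin 3) : Fin n :=
  genIdx n i (s (pivotPos i) t)

theorem perm_fin_three_vals (τ : Equiv.Perm (Fin 3)) :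
    (τ 0 : ℕ) + τ 1 + τ 2 = 3 ∧ (τ 0 : ℕ) ≠ τ 1 ∧ (τ 0 : ℕ) ≠ τ 2 ∧ (τ 1 : ℕ) ≠ τ 2 := by
  revert τ
  decide

theorem pivotLetters_spec {s : Fin 3 → Equiv.Perm (Fin 3)} (hs : ∀ a, s a 0 = a)
    (i : Fin (n - 2)) :
    (pivotLetters n s i 0 : ℕ) % 3 = 0 ∧ (pivotLetters n s i 1 : ℕ) % 3 ≠ 0 ∧
      (pivotLetters n s i 2 : ℕ) % 3 ≠ 0 ∧
      (pivotLetters n s i 1 : ℕ) ≠ pivotLetters n s i 2 ∧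
      (pivotLetters n s i 0 : ℕ) + pivotLetters n s i 1 + pivotLetters n s i 2 = 3 * i + 3 := by
  obtain ⟨h, h₁, h₂, h₃⟩ := perm_fin_three_vals (s (pivotPos i))
  have h₀ : (s (pivotPos i) 0 : ℕ) = 2 * i % 3 := by rw [hs]; rfl
  simp only [pivotLetters, genIdx]
  omega

theorem rel_eq_cubicRel (s : Fin 3 → Equiv.Perm (Fin 3)) (i : Fin (n - 2)) :
    rel k n c i =
      cubicRel (pivotLetters n s) (fun i π => c (s (pivotPos i) * π)) i := by
  rw [rel, ← Equiv.sum_comp (Equiv.mulLeft (s (pivotPos i)))]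
  rfl

theorem pGen_eq_of_mod_three {s : Fin 3 → Equiv.Perm (Fin 3)} (hs : ∀ a, s a 0 = a)
    (i : Fin (n - 2)) {y : Fin n} (hy : (y : ℕ) % 3 = 0) :
    pGen k n c i y = if pivotLetters n s i 0 = y then
      c (s (pivotPos i)) • (FreeAlgebra.ι k (pivotLetters n s i 1) *
        FreeAlgebra.ι k (pivotLetters n s i 2)) +
      c (s (pivotPos i) * Equiv.swap 1 2) • (FreeAlgebra.ι k (pivotLetters n s i 2) *
        FreeAlgebra.ι k (pivotLetters n s i 1)) else 0 := by
  obtain ⟨-, h₁, h₂, -⟩ := pivotLetters_spec (n := n) hs i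
  have n₁ : genIdx n i (s (pivotPos i) 1) ≠ y := by rintro rfl; exact h₁ hy
  have n₂ : genIdx n i (s (pivotPos i) 2) ≠ y := by rintro rfl; exact h₂ hy
  rw [pGen, Finset.sum_filter, ← Equiv.sum_comp (Equiv.mulLeft (s (pivotPos i))),
    sum_perm_fin_three]
  have p1 : finRotate 3 0 = 1 := by decide
  have q1 : (finRotate 3)⁻¹ 0 = 2 := by decide
  have s1 : Equiv.swap (1 : Fin 3) 2 0 = 0 := by decide
  simp only [Equiv.coe_mulLeft, Equiv.Perm.mul_apply, p1, q1, s1, Equiv.swap_apply_left,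
    Equiv.swap_apply_right, n₁, n₂, if_false, add_zero, mul_one]
  by_cases h : genIdx n i (s (pivotPos i) 0) = y <;> simp [pivotLetters, h]

theorem eq_zero_of_sum_Pbar_mul_eq_zero
    (hc : ∀ a : Fin 3, ∃ σ : Equiv.Perm (Fin 3), σ 0 = a ∧ c σ ≠ 0)
    {b : Fin (n - 2) → QuotAlg k n c} (hb : ∀ j, ∑ i, Pbar k n c i j * b i = 0) : b = 0 := by
  choose s hs hs0 using hc
  set L := pivotLetters n s with hLdef
  set d : Fin (n - 2) → Equiv.Perm (Fin 3) → k := fun i π => c (s (pivotPos i) * π) with hddef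
  have spec := fun i => pivotLetters_spec (n := n) hs i
  rw [← hLdef] at spec
  have hL : ∀ i j, L i 0 = L j 0 → L i 1 = L j 1 → L i 2 = L j 2 → i = j := by
    intro i j e₀ e₁ e₂
    have hi := spec i
    rw [e₀, e₁, e₂] at hi
    have hj := spec j
    omega
  have hL' : ∀ i j, L i 0 = L j 0 → L i 1 = L j 2 → L i 2 ≠ L j 1 := by
    intro i j e₀ e₁ e₂
    have hi := spec i
    have hj := spec j
    obtain rfl : i = j := by
      rw [e₀, e₁, e₂] at hi
      omega
    exact hi.2.2.2.1 (congrArg Fin.val e₁)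
  have h₁ : ∀ i j, L i 0 ≠ L j 1 := fun i j e => (spec j).2.1 (e ▸ (spec i).1)
  have h₂ : ∀ i j, L i 0 ≠ L j 2 := fun i j e => (spec j).2.2.1 (e ▸ (spec i).1)
  have hd : ∀ i, d i 1 ≠ 0 := fun i => by simpa [hddef] using hs0 (pivotPos i)
  have hr : ∀ ⦃u v⦄, relRel k n c u v → rewriteAction L d u = rewriteAction L d v := by
    rintro u v ⟨rfl, i, rfl⟩
    rw [rel_eq_cubicRel s, rewriteAction_cubicRel hL hL' h₁ h₂ hd, map_zero]
  have hp : ∀ i, RingQuot.mkAlgHom k (relRel k n c) (cubicRel L d i) = 0 := fun i => by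
    rw [← rel_eq_cubicRel s, mkAlgHom_rel]
  choose u hu using fun i => RingQuot.mkAlgHom_surjective k (relRel k n c) (b i)
  set m : Fin (n - 2) → (List (Fin n) →₀ k) :=
    fun i => rewriteAction L d (u i) (Finsupp.single [] 1) with hm
  have hbm : ∀ i, b i = wordEval (RingQuot.mkAlgHom k (relRel k n c)) (m i) := fun i => by
    rw [hm, wordEval_rewriteAction hL hd hp, hu, wordEval_single]
    simp
  have key : ∀ j, ∑ i, rewriteAction L d (pGen k n c i j) (m i) = 0 := by
    intro j
    have h0 : RingQuot.mkAlgHom k (relRel k n c) (∑ i, pGen k n c i j * u i) = 0 := by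
      rw [← hb j, map_sum]
      simp only [map_mul, hu, Pbar]
    have h : rewriteAction L d (∑ i, pGen k n c i j * u i) = 0 := by
      rw [← RingQuot.liftAlgHom_mkAlgHom_apply k (rewriteAction L d) hr, h0, map_zero]
    have h' := LinearMap.congr_fun h (Finsupp.single [] 1)
    simpa only [map_sum, map_mul, LinearMap.sum_apply, Module.End.mul_apply,
      LinearMap.zero_apply] using h'
  have act₁ : ∀ i, rewriteAction L d (FreeAlgebra.ι k (L i 1)) = consMap k (L i 1) := fun i =>
    rewriteAction_ι_of_forall_ne fun j => h₁ j i
  have act₂ : ∀ i, rewriteAction L d (FreeAlgebra.ι k (L i 2)) = consMap k (L i 2) := fun i =>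
    rewriteAction_ι_of_forall_ne fun j => h₂ j i
  suffices hm0 : ∀ i, m i = 0 from funext fun i => by rw [hbm, hm0, map_zero]; rfl
  intro i
  ext w
  have hi := DFunLike.congr_fun (key (L i 0)) (L i 1 :: L i 2 :: w)
  rw [Finsupp.finsetSum_apply, Finset.sum_eq_single i] at hi
  · rw [pGen_eq_of_mod_three hs i (spec i).1, if_pos rfl] at hi
    have hne : L i 2 ≠ L i 1 := fun e => (spec i).2.2.2.1 (congrArg Fin.val e.symm)
    simp only [← hLdef, map_add, map_smul, map_mul, act₁, act₂, LinearMap.add_apply,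
      LinearMap.smul_apply, Module.End.mul_apply, Finsupp.add_apply, Finsupp.smul_apply,
      consMap_apply_cons, consMap_apply_cons_of_ne hne, smul_eq_mul, mul_zero, add_zero,
      Finsupp.zero_apply] at hi
    exact (mul_eq_zero.1 hi).resolve_left (hs0 _)
  · intro l _ hl
    rw [pGen_eq_of_mod_three hs l (spec i).1]
    split_ifs with h
    · simp only [← hLdef, map_add, map_smul, map_mul, act₁, act₂, LinearMap.add_apply,
        LinearMap.smul_apply, Module.End.mul_apply, Finsupp.add_apply, Finsupp.smul_apply]
      have z₁ : consMap k (L l 1) (consMap k (L l 2) (m l)) (L i 1 :: L i 2 :: w) = 0 := by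
        by_cases e : L l 1 = L i 1
        · rw [e, consMap_apply_cons]
          exact consMap_apply_cons_of_ne (fun e' => hl (hL l i h e e')) _ _
        · exact consMap_apply_cons_of_ne e _ _
      have z₂ : consMap k (L l 2) (consMap k (L l 1) (m l)) (L i 1 :: L i 2 :: w) = 0 := by
        by_cases e : L l 2 = L i 1
        · rw [e, consMap_apply_cons]
          exact consMap_apply_cons_of_ne (fun e' => hL' l i h e' e) _ _
        · exact consMap_apply_cons_of_ne e _ _
      rw [z₁, z₂, smul_zero, smul_zero, add_zero]
    · simp
  · simp

end Injectivity

/-- the sequence of (right) `A`-modules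
`0 → A^{n-2} -f→ A^n -g→ A -ε→ k → 0`, with `g(a₁,…,aₙ) = Σ_j x̄_j a_j` and with the `j`-th
component of `f(b₁,…,b_{n-2})` equal to `Σ_i p̄_{ij} b_i`, is exact: `ε` is surjective,
`ker ε = im g`, `ker g = im f`, and `f` is injective. -/
theorem resolution_exact
    (k : Type) [Field k] (n : ℕ) (hn : 3 ≤ n)
    (c : Equiv.Perm (Fin 3) → k)
    (hc : ∀ a : Fin 3, ∃ σ : Equiv.Perm (Fin 3), σ 0 = a ∧ c σ ≠ 0) :
    Function.Surjective (aug k n c) ∧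
    (∀ a : QuotAlg k n c,
        aug k n c a = 0 ↔ ∃ v : Fin n → QuotAlg k n c, a = ∑ j, Xbar k n c j * v j) ∧
    (∀ v : Fin n → QuotAlg k n c,
        (∑ j, Xbar k n c j * v j) = 0 ↔
          ∃ b : Fin (n - 2) → QuotAlg k n c, ∀ j, v j = ∑ i, Pbar k n c i j * b i) ∧
    (∀ b : Fin (n - 2) → QuotAlg k n c,
        (∀ j, (∑ i, Pbar k n c i j * b i) = 0) → b = 0) := by
  refine ⟨fun r => ⟨algebraMap k _ r, by simp⟩, fun a => ⟨fun ha => ?_, ?_⟩,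
    fun v => ⟨fun hv => ?_, ?_⟩, fun b => eq_zero_of_sum_Pbar_mul_eq_zero hc⟩
  · obtain ⟨v, hv⟩ := exists_eq_aug_add a
    rw [ha, map_zero, zero_add] at hv
    exact ⟨v, hv⟩
  · rintro ⟨v, rfl⟩
    simp [aug_Xbar]
  · obtain ⟨b, rfl⟩ := mem_range_relMap hv
    exact ⟨b, relMap_apply b⟩
  · rintro ⟨b, hb⟩
    simp only [hb, Finset.mul_sum]
    rw [Finset.sum_comm]
    simp only [← mul_assoc, ← Finset.sum_mul, sum_Xbar_mul_Pbar, zero_mul, Finset.sum_const_zero]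

end
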